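/- Fix an integer s ≥ 2, let ξ ∈ ℚ_s ∩ (0, s/(s+1)) be a pseudocenter with associated words w and v, and set ξ_T := .v̌\overline{w̌}. Let x ∈ K(ξ_T) ∩ [0, ξ_L] have the admissible expansion x = .v̌ w̌^{n₁} v w^{n₂} v̌ w̌^{n₃} v w^{n₄} … with all exponents n_j nonnegative integers (all finite). Then x ∈ E if and only if for every k ≥ 1 the shifted sequence satisfies (n₁, n₂, n₃, …) ⪯_ALO (n_k, n_{k+1}, n_{k+2}, …), where ⪯_ALO is the alternate lexicographic order. -/

import Mathlib

/-- The value `.w = Σ εᵢ s^{-i}` of a finite word of digits in base `s`. -/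
noncomputable def sval (s : ℕ) (w : List ℕ) : ℝ :=
  w.foldr (fun d r => ((d : ℝ) + r) / s) 0

/-- The value `.\overline{w}` of the purely periodic base-`s` expansion repeating `w`. -/
noncomputable def pval (s : ℕ) (w : List ℕ) : ℝ :=
  sval s w * (s : ℝ) ^ w.length / ((s : ℝ) ^ w.length - 1)

/-- Digit-wise flip `ε ↦ s − 1 − ε` of a word. -/
def flipw (s : ℕ) (w : List ℕ) : List ℕ := w.map (fun d => s - 1 - d)

/-- `w` is the shortest base-`s` expansion of `x` of even length. -/
noncomputable def IsEvenExp (s : ℕ) (x : ℝ) (w : List ℕ) : Prop :=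
  w ≠ [] ∧ (∀ d ∈ w, d < s) ∧ Even w.length ∧ sval s w = x ∧
  ∀ w' : List ℕ, (∀ d ∈ w', d < s) → Even w'.length → sval s w' = x →
    w.length ≤ w'.length

/-- `v` is the shortest base-`s` expansion of `x` of odd length. -/
noncomputable def IsOddExp (s : ℕ) (x : ℝ) (v : List ℕ) : Prop :=
  (∀ d ∈ v, d < s) ∧ Odd v.length ∧ sval s v = x ∧
  ∀ v' : List ℕ, (∀ d ∈ v', d < s) → Odd v'.length → sval s v' = x →
    v.length ≤ v'.length

/-- `x` is an `s`-adic rational `p/s^m`. -/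
def IsSAdic (s : ℕ) (x : ℝ) : Prop := ∃ p m : ℕ, x = (p : ℝ) / (s : ℝ) ^ m

/-- `m` is the minimal exponent with `x = p/s^m` for some integer `p`. -/
def MinDen (s : ℕ) (x : ℝ) (m : ℕ) : Prop :=
  (∃ p : ℕ, x = (p : ℝ) / (s : ℝ) ^ m) ∧
  ∀ n : ℕ, (∃ p : ℕ, x = (p : ℝ) / (s : ℝ) ^ n) → m ≤ n

/-- The map `g(x) = s(1 − x) mod 1`. -/
noncomputable def gmap (s : ℕ) (x : ℝ) : ℝ := Int.fract ((s : ℝ) * (1 - x))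

/-- The bifurcation set `E = {γ ∈ [0,1] : g^k(γ) ≥ γ for all k ≥ 1}`. -/
noncomputable def Eset (s : ℕ) : Set ℝ :=
  {γ ∈ Set.Icc (0 : ℝ) 1 | ∀ k : ℕ, 1 ≤ k → γ ≤ (gmap s)^[k] γ}

/-- `K(t) = {x ∈ [0,1] : g^k(x) ≥ t for all k ≥ 0}`. -/
noncomputable def Kset (s : ℕ) (t : ℝ) : Set ℝ :=
  {x ∈ Set.Icc (0 : ℝ) 1 | ∀ k : ℕ, t ≤ (gmap s)^[k] x}

/-- `ξ` is the pseudocenter of its connected component of `[0, s/(s+1)] \ E`. -/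
noncomputable def IsPseudocenter (s : ℕ) (ξ : ℝ) : Prop :=
  ξ ∈ Set.Icc (0 : ℝ) ((s : ℝ) / (s + 1)) \ Eset s ∧ IsSAdic s ξ ∧
  ∀ ξ' ∈ connectedComponentIn (Set.Icc (0 : ℝ) ((s : ℝ) / (s + 1)) \ Eset s) ξ,
    IsSAdic s ξ' → ξ' ≠ ξ → ∀ m m' : ℕ, MinDen s ξ m → MinDen s ξ' m' → m < m'

/-- The left endpoint `ξ_T = .v̌\overline{w̌}` of the tuning window generated by `ξ = .w`. -/
noncomputable def xiT (s : ℕ) (w v : List ℕ) : ℝ :=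
  sval s (flipw s v) + pval s (flipw s w) / (s : ℝ) ^ v.length

/-- The `i`-th unit `v̌ w̌^{n_{2i+1}} v w^{n_{2i+2}}` of the admissible expansion
`.v̌ w̌^{n₁} v w^{n₂} v̌ w̌^{n₃} v w^{n₄} …` with exponents `n` (indexed from `0`, so
`n j` is the paper's `n_{j+1}`). -/
def unitBlock (s : ℕ) (w v : List ℕ) (n : ℕ → ℕ) (i : ℕ) : List ℕ :=
  flipw s v ++ (List.replicate (n (2 * i)) (flipw s w)).flatten ++
    v ++ (List.replicate (n (2 * i + 1)) w).flatten

/-- The value of the infinite concatenation of the blocks `σ 0, σ 1, σ 2, …` in base `s`. -/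
noncomputable def concatVal (s : ℕ) (σ : ℕ → List ℕ) : ℝ :=
  ∑' n : ℕ, sval s (σ n) / (s : ℝ) ^ (∑ j ∈ Finset.range n, (σ j).length)

/-- The alternate lexicographic order on sequences of nonnegative integers (indexed from
`0`, corresponding to the paper's indices starting at `1`): at the first index where the
sequences differ, the larger entry wins at the paper's odd positions (Lean-even indices)
and the smaller entry wins at the paper's even positions (Lean-odd indices). -/
def ALOle (a b : ℕ → ℕ) : Prop :=
  a = b ∨ ∃ k : ℕ, (∀ j < k, a j = b j) ∧
    ((Even k ∧ b k < a k) ∨ (¬ Even k ∧ a k < b k))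

/-- Prepends the digits of `u` to the base-`s` expansion of `z`. -/
noncomputable def wordMap (s : ℕ) (u : List ℕ) (z : ℝ) : ℝ :=
  u.foldr (fun (d : ℕ) (r : ℝ) => ((d : ℝ) + r) / s) z

theorem wordMap_nil (s : ℕ) (z : ℝ) : wordMap s [] z = z := rfl

theorem wordMap_cons (s d : ℕ) (u : List ℕ) (z : ℝ) :
    wordMap s (d :: u) z = (d + wordMap s u z) / s := rfl

theorem sval_nil (s : ℕ) : sval s [] = 0 := rfl

theorem sval_cons (s d : ℕ) (u : List ℕ) : sval s (d :: u) = (d + sval s u) / s := rfl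

theorem wordMap_zero (s : ℕ) (u : List ℕ) : wordMap s u 0 = sval s u := by
  induction u with
  | nil => rfl
  | cons d u ih => rw [wordMap_cons, sval_cons, ih]

theorem wordMap_append (s : ℕ) (u u' : List ℕ) (z : ℝ) :
    wordMap s (u ++ u') z = wordMap s u (wordMap s u' z) := by
  simp [wordMap, List.foldr_append]

theorem wordMap_eq (s : ℕ) (u : List ℕ) (z : ℝ) :
    wordMap s u z = sval s u + z / (s : ℝ) ^ u.length := by
  induction u with
  | nil => simp [wordMap_nil, sval_nil]
  | cons d u ih =>
    rw [wordMap_cons, sval_cons, ih, List.length_cons, pow_succ, ← div_div]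
    ring

theorem wordMap_mem_Icc {s : ℕ} (hs : 2 ≤ s) {u : List ℕ} (hu : ∀ d ∈ u, d < s) {z : ℝ}
    (hz : z ∈ Set.Icc (0 : ℝ) 1) : wordMap s u z ∈ Set.Icc (0 : ℝ) 1 := by
  induction u with
  | nil => exact hz
  | cons d u ih =>
    obtain ⟨h0, h1⟩ := ih fun e he => hu e (List.mem_cons_of_mem _ he)
    have hd : (d : ℝ) + 1 ≤ s := by exact_mod_cast hu d List.mem_cons_self
    have hs0 : (0 : ℝ) < s := by positivity
    rw [wordMap_cons]
    refine ⟨by positivity, ?_⟩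
    rw [div_le_one hs0]
    linarith

theorem sval_nonneg (s : ℕ) (u : List ℕ) : 0 ≤ sval s u := by
  induction u with
  | nil => rw [sval_nil]
  | cons d u ih =>
    rw [sval_cons]
    positivity

theorem sval_add_inv_pow_le_one {s : ℕ} (hs : 2 ≤ s) {u : List ℕ} (hu : ∀ d ∈ u, d < s) :
    sval s u + 1 / (s : ℝ) ^ u.length ≤ 1 := by
  rw [← wordMap_eq]
  exact (wordMap_mem_Icc hs hu (by simp)).2

theorem sval_lt_one {s : ℕ} (hs : 2 ≤ s) {u : List ℕ} (hu : ∀ d ∈ u, d < s) :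
    sval s u < 1 := by
  have h := sval_add_inv_pow_le_one hs hu
  have : 0 < 1 / (s : ℝ) ^ u.length := by positivity
  linarith

theorem exists_int_pow_mul_wordMap {s : ℕ} (hs : 2 ≤ s) (u : List ℕ) (z : ℝ) {i : ℕ}
    (hi : i ≤ u.length) :
    ∃ k : ℤ, (s : ℝ) ^ i * wordMap s u z = k + wordMap s (u.drop i) z := by
  induction i generalizing u with
  | zero => exact ⟨0, by simp⟩
  | succ i ih =>
    cases u with
    | nil => simp at hi
    | cons d u =>
      obtain ⟨k, hk⟩ := ih u (by simpa using hi)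
      have hs0 : (s : ℝ) ≠ 0 := by positivity
      refine ⟨s ^ i * d + k, ?_⟩
      rw [List.drop_succ_cons, wordMap_cons]
      push_cast
      rw [pow_succ, add_assoc, ← hk]
      field_simp

theorem exists_int_pow_mul_sval {s : ℕ} (hs : 2 ≤ s) (u : List ℕ) {i : ℕ}
    (hi : i ≤ u.length) :
    ∃ k : ℤ, (s : ℝ) ^ i * sval s u = k + sval s (u.drop i) := by
  simpa only [wordMap_zero] using exists_int_pow_mul_wordMap hs u 0 hi

theorem exists_int_pow_length_mul_sval {s : ℕ} (hs : 2 ≤ s) (u : List ℕ) :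
    ∃ k : ℤ, (s : ℝ) ^ u.length * sval s u = k := by
  obtain ⟨k, hk⟩ := exists_int_pow_mul_sval hs u le_rfl
  rw [List.drop_length, sval_nil, add_zero] at hk
  exact ⟨k, hk⟩

theorem sval_take_of_pow_mul_eq_int {s : ℕ} (hs : 2 ≤ s) {u : List ℕ} (hu : ∀ d ∈ u, d < s)
    {i : ℕ} (hi : i ≤ u.length) {k : ℤ} (hk : (s : ℝ) ^ i * sval s u = k) :
    sval s (u.take i) = sval s u := by
  obtain ⟨l, hl⟩ := exists_int_pow_mul_sval hs u hi
  have h0 := sval_nonneg s (u.drop i)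
  have h1 := sval_lt_one hs (u := u.drop i) fun d hd => hu d (List.mem_of_mem_drop hd)
  have hd : sval s (u.drop i) = ((k - l : ℤ) : ℝ) := by push_cast; linarith
  rw [hd] at h0 h1
  have : k - l = 0 := by
    have a : 0 ≤ k - l := by exact_mod_cast h0
    have b : k - l < 1 := by exact_mod_cast h1
    omega
  rw [this] at hd
  have h2 : sval s u = wordMap s (u.take i) (sval s (u.drop i)) := by
    rw [← wordMap_zero s (u.drop i), ← wordMap_append, List.take_append_drop, wordMap_zero]
  rw [h2, hd, Int.cast_zero, wordMap_zero]

theorem wordMap_flipw {s : ℕ} (hs : 2 ≤ s) {u : List ℕ} (hu : ∀ d ∈ u, d < s) (z : ℝ) :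
    wordMap s (flipw s u) (1 - z) = 1 - wordMap s u z := by
  induction u with
  | nil => rfl
  | cons d u ih =>
    have hd : d < s := hu d List.mem_cons_self
    have hs0 : (s : ℝ) ≠ 0 := by positivity
    have hc : ((s - 1 - d : ℕ) : ℝ) = s - 1 - d := by
      rw [Nat.cast_sub (by omega), Nat.cast_sub (by omega), Nat.cast_one]
    have hf : flipw s (d :: u) = (s - 1 - d) :: flipw s u := rfl
    rw [hf, wordMap_cons, wordMap_cons, ih fun e he => hu e (List.mem_cons_of_mem _ he), hc]
    field_simp
    ring

theorem flipw_lt {s : ℕ} (hs : 2 ≤ s) (u : List ℕ) : ∀ d ∈ flipw s u, d < s := by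
  intro d hd
  simp only [flipw, List.mem_map] at hd
  obtain ⟨e, -, rfl⟩ := hd
  omega

theorem flipw_append (s : ℕ) (u u' : List ℕ) : flipw s (u ++ u') = flipw s u ++ flipw s u' := by
  simp [flipw]

theorem flatten_replicate_flipw (s : ℕ) (u : List ℕ) (r : ℕ) :
    (List.replicate r (flipw s u)).flatten = flipw s (List.replicate r u).flatten := by
  induction r with
  | zero => simp [flipw]
  | succ r ih => simp only [List.replicate_succ, List.flatten_cons, ih, flipw_append]

theorem flatten_replicate_lt {s : ℕ} {u : List ℕ} (hu : ∀ d ∈ u, d < s) (r : ℕ) :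
    ∀ d ∈ (List.replicate r u).flatten, d < s := by
  intro d hd
  simp only [List.mem_flatten, List.mem_replicate] at hd
  obtain ⟨_, ⟨-, rfl⟩, hd⟩ := hd
  exact hu d hd

theorem gmap_iterate_succ (s : ℕ) (x : ℝ) (k : ℕ) :
    (gmap s)^[k + 1] x = Int.fract ((-(s : ℝ)) ^ (k + 1) * x) := by
  have key (t : ℝ) : gmap s (Int.fract t) = Int.fract (-(s : ℝ) * t) := by
    have : (s : ℝ) * (1 - Int.fract t) = -(s : ℝ) * t + ((s + s * ⌊t⌋ : ℤ) : ℝ) := by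
      rw [Int.fract]; push_cast; ring
    rw [gmap, this, Int.fract_add_intCast]
  induction k with
  | zero =>
    have : (s : ℝ) * (1 - x) = -(s : ℝ) * x + ((s : ℤ) : ℝ) := by push_cast; ring
    simp only [zero_add, Function.iterate_one, pow_one]
    rw [gmap, this, Int.fract_add_intCast]
  | succ k ih => rw [Function.iterate_succ_apply', ih, key, ← mul_assoc, ← pow_succ']

theorem gmap_iterate_of_pos (s : ℕ) (x : ℝ) {k : ℕ} (hk : 1 ≤ k) :
    (gmap s)^[k] x = Int.fract ((-(s : ℝ)) ^ k * x) := by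
  obtain ⟨k, rfl⟩ := Nat.exists_eq_add_of_le' hk
  exact gmap_iterate_succ s x k

theorem fract_le_sub_of_le {y : ℝ} {q : ℤ} (h : (q : ℝ) ≤ y) : Int.fract y ≤ y - q := by
  have : (q : ℝ) ≤ ⌊y⌋ := by exact_mod_cast Int.le_floor.2 h
  rw [Int.fract]
  linarith

/-- Iterates of `g` on the base-`s` expansion `.u z`: shift, and flip after an odd number of
steps. -/
theorem gmap_iterate_wordMap {s : ℕ} (hs : 2 ≤ s) {u : List ℕ} (hu : ∀ d ∈ u, d < s) {z : ℝ}
    (hz : z ∈ Set.Icc (0 : ℝ) 1) {i : ℕ} (hi : i ≤ u.length)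
    (hpos : 0 < (gmap s)^[i] (wordMap s u z)) :
    (Even i → (gmap s)^[i] (wordMap s u z) = wordMap s (u.drop i) z) ∧
    (Odd i → (gmap s)^[i] (wordMap s u z) = 1 - wordMap s (u.drop i) z) := by
  rcases Nat.eq_zero_or_pos i with rfl | hi0
  · simp
  obtain ⟨k, hk⟩ := exists_int_pow_mul_wordMap hs u z hi
  obtain ⟨h0, h1⟩ := wordMap_mem_Icc hs (u := u.drop i)
    (fun d hd => hu d (List.mem_of_mem_drop hd)) hz
  rw [gmap_iterate_of_pos s _ hi0] at hpos ⊢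
  generalize wordMap s (u.drop i) z = t at *
  constructor
  · intro he
    rw [he.neg_pow, hk, add_comm, Int.fract_add_intCast] at hpos ⊢
    have : t ≠ 1 := by rintro rfl; simp at hpos
    exact Int.fract_eq_self.2 ⟨h0, lt_of_le_of_ne h1 this⟩
  · intro ho
    have e : (-(s : ℝ)) ^ i * wordMap s u z = 1 - t + ((-k - 1 : ℤ) : ℝ) := by
      rw [ho.neg_pow]; push_cast; linarith
    rw [e, Int.fract_add_intCast] at hpos ⊢
    have : t ≠ 0 := by rintro rfl; simp at hpos
    refine Int.fract_eq_self.2 ⟨by linarith, ?_⟩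
    have := lt_of_le_of_ne h0 this.symm
    linarith

theorem zero_mem_Eset (s : ℕ) : (0 : ℝ) ∈ Eset s := by
  refine ⟨by simp, fun k hk => ?_⟩
  rw [gmap_iterate_of_pos s _ hk]
  simp

theorem div_succ_mem_Eset (s : ℕ) : (s : ℝ) / (s + 1) ∈ Eset s := by
  have h0 : (0 : ℝ) ≤ (s : ℝ) / (s + 1) := by positivity
  have h1 : (s : ℝ) / (s + 1) < 1 := by
    rw [div_lt_one (by positivity)]; linarith
  refine ⟨⟨h0, h1.le⟩, fun k _ => ?_⟩
  have hfix : gmap s ((s : ℝ) / (s + 1)) = (s : ℝ) / (s + 1) := by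
    have : (s : ℝ) * (1 - (s : ℝ) / (s + 1)) = (s : ℝ) / (s + 1) := by field_simp; ring
    rw [gmap, this]
    exact Int.fract_eq_self.2 ⟨h0, h1⟩
  rw [Function.iterate_fixed hfix]

namespace IsPseudocenter

variable {s : ℕ} {ξ : ℝ}

theorem pos (hξ : IsPseudocenter s ξ) : 0 < ξ := by
  refine lt_of_le_of_ne hξ.1.1.1 ?_
  rintro rfl
  exact hξ.1.2 (zero_mem_Eset s)

theorem lt_div (hξ : IsPseudocenter s ξ) : ξ < (s : ℝ) / (s + 1) := by
  refine lt_of_le_of_ne hξ.1.1.2 ?_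
  rintro h
  exact hξ.1.2 (h ▸ div_succ_mem_Eset s)

theorem lt_one (hξ : IsPseudocenter s ξ) : ξ < 1 := by
  refine hξ.lt_div.trans_le ?_
  rw [div_le_one (by positivity)]
  linarith

theorem exists_mem_Eset (hs : 2 ≤ s) (hξ : IsPseudocenter s ξ) {i : ℕ}
    (hi : ∀ k : ℤ, (s : ℝ) ^ i * ξ ≠ k) {p : ℕ}
    (hp : (p : ℝ) / (s : ℝ) ^ i ≤ (s : ℝ) / (s + 1)) :
    ∃ e ∈ Eset s, e ∈ Set.uIcc ((p : ℝ) / (s : ℝ) ^ i) ξ := by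
  by_contra! hcon
  have hs0 : (s : ℝ) ≠ 0 := by positivity
  set a : ℝ := (p : ℝ) / (s : ℝ) ^ i with ha
  have hsub : Set.uIcc a ξ ⊆ Set.Icc (0 : ℝ) ((s : ℝ) / (s + 1)) \ Eset s := fun e he =>
    ⟨Set.uIcc_subset_Icc ⟨by positivity, hp⟩ hξ.1.1 he, fun hE => hcon e hE he⟩
  have hmem := (isPreconnected_uIcc.subset_connectedComponentIn Set.right_mem_uIcc hsub)
    (Set.left_mem_uIcc (a := a) (b := ξ))
  have minDen {y : ℝ} (hy : IsSAdic s y) : ∃ m, MinDen s y m := by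
    classical
    have h : ∃ m, ∃ p : ℕ, y = (p : ℝ) / (s : ℝ) ^ m := by
      obtain ⟨p, m, h⟩ := hy
      exact ⟨m, p, h⟩
    exact ⟨Nat.find h, Nat.find_spec h, fun n hn => Nat.find_min' h hn⟩
  have hne : a ≠ ξ := by
    intro h
    apply hi p
    rw [← h, ha]
    push_cast
    field_simp
  obtain ⟨m, hm⟩ := minDen hξ.2.1
  obtain ⟨m', hm'⟩ := minDen (y := a) ⟨p, i, ha⟩
  have hlt := hξ.2.2 a hmem ⟨p, i, ha⟩ hne m m' hm hm'
  have hle := hm'.2 i ⟨p, ha⟩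
  obtain ⟨⟨q, hq⟩, -⟩ := hm
  obtain ⟨j, rfl⟩ := Nat.exists_eq_add_of_le (show m ≤ i by omega)
  apply hi (s ^ j * q)
  rw [hq]
  push_cast
  field_simp
  ring

theorem pow_mul_add_self_lt (hs : 2 ≤ s) (hξ : IsPseudocenter s ξ) {i : ℕ} (hi : Odd i)
    {q : ℤ} (hq : (s : ℝ) ^ i * ξ < q) : (s : ℝ) ^ i * ξ + ξ < q := by
  have hpow : (0 : ℝ) < (s : ℝ) ^ i := by positivity
  by_cases hnint : ∃ k : ℤ, (s : ℝ) ^ i * ξ = k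
  · obtain ⟨k, hk⟩ := hnint
    rw [hk] at hq ⊢
    have : (k : ℝ) + 1 ≤ q := by exact_mod_cast hq
    linarith [hξ.lt_one]
  push Not at hnint
  obtain ⟨p, rfl⟩ : ∃ p : ℕ, q = p := by
    refine ⟨q.toNat, (Int.toNat_of_nonneg ?_).symm⟩
    have : (0 : ℝ) < q := (mul_pos hpow hξ.pos).trans hq
    exact_mod_cast this.le
  push_cast at hq ⊢
  have hlt : ξ < (p : ℝ) / (s : ℝ) ^ i := by
    rw [lt_div_iff₀ hpow]; linarith
  obtain ⟨e, heE, hξe, hep⟩ : ∃ e ∈ Eset s, ξ < e ∧ e ≤ (p : ℝ) / (s : ℝ) ^ i := by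
    rcases le_total ((p : ℝ) / (s : ℝ) ^ i) ((s : ℝ) / (s + 1)) with h | h
    · obtain ⟨e, heE, he⟩ := hξ.exists_mem_Eset hs hnint h
      rw [Set.uIcc_of_ge hlt.le] at he
      refine ⟨e, heE, lt_of_le_of_ne he.1 ?_, he.2⟩
      rintro rfl
      exact hξ.1.2 heE
    · exact ⟨_, div_succ_mem_Eset s, hξ.lt_div, h⟩
  rw [le_div_iff₀ hpow] at hep
  have h1 := heE.2 i hi.pos
  rw [gmap_iterate_of_pos s _ hi.pos, hi.neg_pow] at h1
  have h2 := fract_le_sub_of_le (y := -(s : ℝ) ^ i * e) (q := -p) (by push_cast; linarith)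
  push_cast at h2
  have := mul_lt_mul_of_pos_left hξe hpow
  linarith

theorem add_self_lt_pow_mul (hs : 2 ≤ s) (hξ : IsPseudocenter s ξ) {i : ℕ} (hi : Even i)
    (hi0 : i ≠ 0) (hnint : ∀ k : ℤ, (s : ℝ) ^ i * ξ ≠ k) {q : ℤ}
    (hq : (q : ℝ) ≤ (s : ℝ) ^ i * ξ) : q + ξ < (s : ℝ) ^ i * ξ := by
  have hpow : (0 : ℝ) < (s : ℝ) ^ i := by positivity
  have hpow1 : (1 : ℝ) < (s : ℝ) ^ i := one_lt_pow₀ (by exact_mod_cast hs) hi0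
  rcases lt_or_ge q 0 with hneg | hnonneg
  · have : (q : ℝ) + 1 ≤ 0 := by exact_mod_cast hneg
    have := mul_pos hpow hξ.pos
    linarith [hξ.lt_one]
  lift q to ℕ using hnonneg
  push_cast at hq ⊢
  have hlt : (q : ℝ) / (s : ℝ) ^ i ≤ ξ := by
    rw [div_le_iff₀ hpow]; linarith
  obtain ⟨e, heE, he⟩ := hξ.exists_mem_Eset hs hnint (hlt.trans hξ.lt_div.le)
  rw [Set.uIcc_of_le hlt, Set.mem_Icc, div_le_iff₀ hpow] at he
  have heξ : e < ξ := by
    refine lt_of_le_of_ne he.2 ?_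
    rintro rfl
    exact hξ.1.2 heE
  have h1 := heE.2 i (by omega)
  rw [gmap_iterate_of_pos s _ (by omega), hi.neg_pow] at h1
  have h2 := fract_le_sub_of_le (y := (s : ℝ) ^ i * e) (q := q) (by push_cast; linarith)
  push_cast at h2
  nlinarith

/-- An odd-length digit block whose right endpoint exceeds `ξ`, continued by the flip of a point
`z ≤ ξ + s^{-D}`, stays above `ξ`. -/
theorem le_sub_div (hs : 2 ≤ s) (hξ : IsPseudocenter s ξ) {D : ℕ}
    (hD : ∃ N : ℤ, (s : ℝ) ^ D * ξ = N) {L : ℕ} (hL : Odd L) {q : ℤ}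
    (hq : (s : ℝ) ^ L * ξ < q) {z : ℝ} (hz : z ≤ ξ + 1 / (s : ℝ) ^ D) :
    (s : ℝ) ^ L * ξ ≤ q - z := by
  have hlt := hξ.pow_mul_add_self_lt hs hL hq
  obtain ⟨N, hN⟩ := hD
  have hpow : (0 : ℝ) < (s : ℝ) ^ D := by positivity
  have h1 : (((s : ℤ) ^ L * N + N : ℤ) : ℝ) < (((s : ℤ) ^ D * q : ℤ) : ℝ) := by
    push_cast
    rw [← hN]
    nlinarith
  have h2 : (((s : ℤ) ^ L * N + N : ℤ) : ℝ) + 1 ≤ (((s : ℤ) ^ D * q : ℤ) : ℝ) := by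
    exact_mod_cast h1
  push_cast at h2
  rw [← hN] at h2
  have h3 : (s : ℝ) ^ L * ξ + ξ + 1 / (s : ℝ) ^ D ≤ q := by
    have e : (s : ℝ) ^ L * ξ + ξ + 1 / (s : ℝ) ^ D =
        ((s : ℝ) ^ L * ((s : ℝ) ^ D * ξ) + (s : ℝ) ^ D * ξ + 1) / (s : ℝ) ^ D := by
      field_simp
    rw [e, div_le_iff₀ hpow]
    linarith
  linarith

end IsPseudocenter

section Words

variable {s : ℕ} {ξ : ℝ} {w v : List ℕ}

theorem IsEvenExp.pow_mul_ne (hs : 2 ≤ s) (hw : IsEvenExp s ξ w) {i : ℕ} (hi : Even i)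
    (hlt : i < w.length) (k : ℤ) : (s : ℝ) ^ i * ξ ≠ k := by
  obtain ⟨-, hd, -, rfl, hmin⟩ := hw
  intro hk
  have := hmin (w.take i) (fun d h => hd d (List.mem_of_mem_take h)) (by simpa [hlt.le] using hi)
    (sval_take_of_pow_mul_eq_int hs hd hlt.le hk)
  simp at this
  omega

theorem IsOddExp.pow_mul_ne (hs : 2 ≤ s) (hv : IsOddExp s (1 - ξ) v) {i : ℕ} (hi : Odd i)
    (hlt : i < v.length) (k : ℤ) : (s : ℝ) ^ i * ξ ≠ k := by
  obtain ⟨hd, -, hval, hmin⟩ := hv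
  intro hk
  rw [← hval] at hmin
  have := hmin (v.take i) (fun d h => hd d (List.mem_of_mem_take h)) (by simpa [hlt.le] using hi)
    (sval_take_of_pow_mul_eq_int hs hd hlt.le (k := s ^ i - k) (by
      rw [hval]; push_cast; rw [← hk]; ring))
  simp at this
  omega

theorem IsEvenExp.pow_length_mul (hs : 2 ≤ s) (hw : IsEvenExp s ξ w) :
    ∃ N : ℤ, (s : ℝ) ^ w.length * ξ = N := by
  obtain ⟨-, -, -, rfl, -⟩ := hw
  exact exists_int_pow_length_mul_sval hs w

/-- Interior positions of a block `w` followed by `z`. -/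
theorem le_gmap_iterate_wordMap_even (hs : 2 ≤ s) (hξ : IsPseudocenter s ξ)
    (hw : IsEvenExp s ξ w) {z : ℝ} (hz : z ∈ Set.Icc (0 : ℝ) 1)
    (hzξ : z ≤ ξ + 1 / (s : ℝ) ^ w.length) {i : ℕ} (hi : i < w.length)
    (hpos : 0 < (gmap s)^[i] (wordMap s w z)) : ξ ≤ (gmap s)^[i] (wordMap s w z) := by
  obtain ⟨hE, hO⟩ := gmap_iterate_wordMap hs hw.2.1 hz hi.le hpos
  have hs0 : (0 : ℝ) < s := by positivity
  have hval := hw.2.2.2.1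
  have hdrop : ∀ d ∈ w.drop i, d < s := fun d hd => hw.2.1 d (List.mem_of_mem_drop hd)
  obtain ⟨k, hk⟩ := exists_int_pow_mul_sval hs w hi.le
  rw [hval] at hk
  have hd0 := sval_nonneg s (w.drop i)
  have hd1 := sval_lt_one hs hdrop
  rcases Nat.even_or_odd i with he | ho
  · rw [hE he]
    rcases Nat.eq_zero_or_pos i with rfl | hi0
    · rw [List.drop_zero, wordMap_eq, hval]
      have := div_nonneg hz.1 (pow_pos hs0 w.length).le
      linarith
    have h := hξ.add_self_lt_pow_mul hs he hi0.ne' (hw.pow_mul_ne hs he hi) (q := k)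
      (by linarith)
    rw [wordMap_eq]
    have := div_nonneg hz.1 (pow_pos hs0 (w.drop i).length).le
    linarith
  · rw [hO ho, wordMap_eq]
    have hL : Odd (w.drop i).length := by
      rw [List.length_drop]
      exact Nat.Even.sub_odd hi.le hw.2.2.1 ho
    obtain ⟨l, hl⟩ := exists_int_pow_length_mul_sval hs (w.drop i)
    have h := hξ.pow_mul_add_self_lt hs ho (q := k + 1) (by push_cast; linarith)
    push_cast at h
    have hp := pow_pos hs0 (w.drop i).length
    have hq : (s : ℝ) ^ (w.drop i).length * ξ < ((s ^ (w.drop i).length - l : ℤ) : ℝ) := by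
      push_cast
      rw [← hl]
      nlinarith
    have hfin := hξ.le_sub_div hs (hw.pow_length_mul hs) hL hq hzξ
    push_cast at hfin
    rw [← hl] at hfin
    have e : 1 - (sval s (w.drop i) + z / (s : ℝ) ^ (w.drop i).length) =
        ((s : ℝ) ^ (w.drop i).length - (s : ℝ) ^ (w.drop i).length * sval s (w.drop i) - z) /
          (s : ℝ) ^ (w.drop i).length := by
      field_simp
      ring
    rw [e, le_div_iff₀ hp]
    linarith

/-- Interior positions of a block `v̌` followed by the flip of `z`. -/
theorem le_gmap_iterate_wordMap_odd (hs : 2 ≤ s) (hξ : IsPseudocenter s ξ)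
    (hw : IsEvenExp s ξ w) (hv : IsOddExp s (1 - ξ) v) {z : ℝ} (hz : z ∈ Set.Icc (0 : ℝ) 1)
    (hzξ : z ≤ ξ + 1 / (s : ℝ) ^ w.length) {i : ℕ} (hi0 : i ≠ 0) (hi : i < v.length)
    (hpos : 0 < (gmap s)^[i] (wordMap s (flipw s v) (1 - z))) :
    ξ ≤ (gmap s)^[i] (wordMap s (flipw s v) (1 - z)) := by
  have hz' : 1 - z ∈ Set.Icc (0 : ℝ) 1 := ⟨by linarith [hz.2], by linarith [hz.1]⟩
  obtain ⟨hE, hO⟩ := gmap_iterate_wordMap hs (flipw_lt hs v) hz' (by simpa [flipw] using hi.le) hpos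
  have hs0 : (0 : ℝ) < s := by positivity
  have hval := hv.2.2.1
  have hdrop : ∀ d ∈ v.drop i, d < s := fun d hd => hv.1 d (List.mem_of_mem_drop hd)
  have hflip : wordMap s ((flipw s v).drop i) (1 - z) = 1 - wordMap s (v.drop i) z := by
    rw [← wordMap_flipw hs hdrop]
    simp [flipw, List.map_drop]
  obtain ⟨k, hk⟩ := exists_int_pow_mul_sval hs v hi.le
  rw [hval] at hk
  have hd0 := sval_nonneg s (v.drop i)
  have hd1 := sval_lt_one hs hdrop
  rcases Nat.even_or_odd i with he | ho
  · rw [hE he, hflip, wordMap_eq]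
    have hL : Odd (v.drop i).length := by
      rw [List.length_drop]
      exact Nat.Odd.sub_even hi.le hv.2.1 he
    obtain ⟨l, hl⟩ := exists_int_pow_length_mul_sval hs (v.drop i)
    have h : ξ + sval s (v.drop i) < 1 := by
      by_cases hnint : ∃ m : ℤ, (s : ℝ) ^ i * ξ = m
      · obtain ⟨m, hm⟩ := hnint
        have hz0 : sval s (v.drop i) = ((s ^ i - m - k : ℤ) : ℝ) := by
          push_cast; linarith
        rw [hz0] at hd0 hd1
        have h0 : (s ^ i - m - k : ℤ) = 0 := by
          have a : (0 : ℤ) ≤ s ^ i - m - k := by exact_mod_cast hd0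
          have b : (s ^ i - m - k : ℤ) < 1 := by exact_mod_cast hd1
          omega
        rw [hz0, h0]
        simpa using hξ.lt_one
      · push Not at hnint
        have h := hξ.add_self_lt_pow_mul hs he hi0 hnint (q := s ^ i - k - 1)
          (by push_cast; linarith)
        push_cast at h
        linarith
    have hp := pow_pos hs0 (v.drop i).length
    have hq : (s : ℝ) ^ (v.drop i).length * ξ < ((s ^ (v.drop i).length - l : ℤ) : ℝ) := by
      push_cast
      rw [← hl]
      nlinarith
    have hfin := hξ.le_sub_div hs (hw.pow_length_mul hs) hL hq hzξ
    push_cast at hfin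
    rw [← hl] at hfin
    have e : 1 - (sval s (v.drop i) + z / (s : ℝ) ^ (v.drop i).length) =
        ((s : ℝ) ^ (v.drop i).length - (s : ℝ) ^ (v.drop i).length * sval s (v.drop i) - z) /
          (s : ℝ) ^ (v.drop i).length := by
      field_simp
      ring
    rw [e, le_div_iff₀ hp]
    linarith
  · rw [hO ho, hflip, wordMap_eq]
    have hne := hv.pow_mul_ne hs ho hi
    have hlt : (s : ℝ) ^ i * ξ < ((s ^ i - k : ℤ) : ℝ) := by
      refine lt_of_le_of_ne ?_ (hne _)
      push_cast
      linarith
    have h := hξ.pow_mul_add_self_lt hs ho hlt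
    push_cast at h
    have := div_nonneg hz.1 (pow_pos hs0 (v.drop i).length).le
    linarith

theorem xiT_pos (hs : 2 ≤ s) (hξ : IsPseudocenter s ξ) (hw : IsEvenExp s ξ w) :
    0 < xiT s w v := by
  have hs2 : (2 : ℝ) ≤ s := by exact_mod_cast hs
  have hlen : 2 ≤ w.length := by
    obtain ⟨hne, -, ⟨r, hr⟩, -⟩ := hw
    have := List.length_pos_of_ne_nil hne
    omega
  have hpow : (s : ℝ) ^ 2 ≤ (s : ℝ) ^ w.length := pow_le_pow_right₀ (by linarith) hlen
  have hflip : sval s (flipw s w) = 1 - ξ - 1 / (s : ℝ) ^ w.length := by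
    have := wordMap_flipw hs hw.2.1 1
    rw [sub_self, wordMap_eq s w, hw.2.2.2.1] at this
    rw [← wordMap_zero, this]; ring
  have hpos : 0 < sval s (flipw s w) := by
    have h1 : 1 / (s : ℝ) ^ w.length ≤ 1 / (s : ℝ) ^ 2 :=
      one_div_le_one_div_of_le (by positivity) hpow
    have h2 : 1 / (s : ℝ) ^ 2 < 1 - (s : ℝ) / (s + 1) := by
      have : 1 - (s : ℝ) / (s + 1) = 1 / (s + 1) := by field_simp; ring
      rw [this]
      exact one_div_lt_one_div_of_lt (by positivity) (by nlinarith)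
    have := hξ.lt_div
    rw [hflip]
    linarith
  have hfl : (flipw s w).length = w.length := by simp [flipw]
  have h1 : 0 < (s : ℝ) ^ w.length - 1 := by nlinarith
  have h2 := sval_nonneg s (flipw s v)
  have h3 : 0 < pval s (flipw s w) := by
    rw [pval, hfl]
    positivity
  rw [xiT]
  positivity

end Words

section Concat

variable {s : ℕ} {σ : ℕ → List ℕ}

theorem sum_range_concat_add_le_one (hs : 2 ≤ s) (hσ : ∀ i, ∀ d ∈ σ i, d < s) (N : ℕ) :
    ∑ i ∈ Finset.range N, sval s (σ i) / (s : ℝ) ^ (∑ j ∈ Finset.range i, (σ j).length) +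
      1 / (s : ℝ) ^ (∑ j ∈ Finset.range N, (σ j).length) ≤ 1 := by
  induction N with
  | zero => simp
  | succ N ih =>
    rw [Finset.sum_range_succ, Finset.sum_range_succ (fun j => (σ j).length) N, pow_add]
    have h := sval_add_inv_pow_le_one hs (hσ N)
    have hp : (0 : ℝ) < (s : ℝ) ^ (∑ j ∈ Finset.range N, (σ j).length) := by positivity
    have h' := div_le_div_of_nonneg_right h hp.le
    rw [add_div, div_div] at h'
    rw [mul_comm ((s : ℝ) ^ (∑ j ∈ Finset.range N, (σ j).length))]
    linarith

theorem concat_term_nonneg (s : ℕ) (σ : ℕ → List ℕ) (i : ℕ) :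
    0 ≤ sval s (σ i) / (s : ℝ) ^ (∑ j ∈ Finset.range i, (σ j).length) :=
  div_nonneg (sval_nonneg s _) (by positivity)

theorem sum_range_concat_le_one (hs : 2 ≤ s) (hσ : ∀ i, ∀ d ∈ σ i, d < s) (N : ℕ) :
    ∑ i ∈ Finset.range N, sval s (σ i) / (s : ℝ) ^ (∑ j ∈ Finset.range i, (σ j).length) ≤ 1 := by
  have h := sum_range_concat_add_le_one hs hσ N
  have : 0 ≤ 1 / (s : ℝ) ^ (∑ j ∈ Finset.range N, (σ j).length) := by positivity
  linarith

theorem summable_concat (hs : 2 ≤ s) (hσ : ∀ i, ∀ d ∈ σ i, d < s) :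
    Summable fun i => sval s (σ i) / (s : ℝ) ^ (∑ j ∈ Finset.range i, (σ j).length) :=
  summable_of_sum_range_le (concat_term_nonneg s σ) (sum_range_concat_le_one hs hσ)

theorem concatVal_mem_Icc (hs : 2 ≤ s) (hσ : ∀ i, ∀ d ∈ σ i, d < s) :
    concatVal s σ ∈ Set.Icc (0 : ℝ) 1 :=
  ⟨tsum_nonneg (concat_term_nonneg s σ),
    Real.tsum_le_of_sum_range_le (concat_term_nonneg s σ) (sum_range_concat_le_one hs hσ)⟩

theorem concatVal_succ (hs : 2 ≤ s) (hσ : ∀ i, ∀ d ∈ σ i, d < s) :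
    concatVal s σ = wordMap s (σ 0) (concatVal s fun i => σ (i + 1)) := by
  rw [wordMap_eq, concatVal, (summable_concat hs hσ).tsum_eq_zero_add, concatVal, ← tsum_div_const]
  simp only [Finset.range_zero, Finset.sum_empty, pow_zero, div_one]
  congr 1
  refine tsum_congr fun i => ?_
  rw [Finset.sum_range_succ' (fun j => (σ j).length), pow_add, div_div]

end Concat

/-- The sequences `y` of values of the successive tails (flipped at odd indices, so that each
starts with `v̌`) of an admissible expansion with exponents `n`. -/
structure IsTailSeq (s : ℕ) (w v : List ℕ) (n : ℕ → ℕ) (y : ℕ → ℝ) : Prop where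
  mem_Icc : ∀ k, y k ∈ Set.Icc (0 : ℝ) 1
  eq_wordMap : ∀ k, y k =
    wordMap s (flipw s v) (1 - wordMap s (List.replicate (n k) w).flatten (y (k + 1)))

theorem exists_isTailSeq {s : ℕ} (hs : 2 ≤ s) {w v : List ℕ} (hw : ∀ d ∈ w, d < s)
    (hv : ∀ d ∈ v, d < s) (n : ℕ → ℕ) :
    ∃ y, IsTailSeq s w v n y ∧ y 0 = concatVal s (unitBlock s w v n) := by
  have hblock : ∀ i, ∀ d ∈ unitBlock s w v n i, d < s := by
    intro i d hd
    simp only [unitBlock, List.mem_append] at hd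
    rcases hd with ((h | h) | h) | h
    · exact flipw_lt hs v d h
    · exact flatten_replicate_lt (flipw_lt hs w) _ d h
    · exact hv d h
    · exact flatten_replicate_lt hw _ d h
  let X : ℕ → ℝ := fun j => concatVal s fun i => unitBlock s w v n (i + j)
  have hX : ∀ j, X j ∈ Set.Icc (0 : ℝ) 1 := fun j => concatVal_mem_Icc hs fun i => hblock _
  let Y : ℕ → ℝ := fun j => wordMap s v (wordMap s (List.replicate (n (2 * j + 1)) w).flatten
    (X (j + 1)))
  have hY : ∀ j, Y j ∈ Set.Icc (0 : ℝ) 1 := fun j =>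
    wordMap_mem_Icc hs hv (wordMap_mem_Icc hs (flatten_replicate_lt hw _) (hX _))
  have hXY : ∀ j, X j = wordMap s (flipw s v)
      (1 - wordMap s (List.replicate (n (2 * j)) w).flatten (1 - Y j)) := by
    intro j
    have h : X j = wordMap s (unitBlock s w v n j) (X (j + 1)) := by
      change concatVal s _ = _
      rw [concatVal_succ hs fun i => hblock _]
      simp only [zero_add, X, add_right_comm, add_assoc]
    rw [h, unitBlock, wordMap_append, wordMap_append, wordMap_append, flatten_replicate_flipw,
      ← wordMap_flipw hs (flatten_replicate_lt hw _), sub_sub_cancel]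
  refine ⟨fun k => if Even k then X (k / 2) else 1 - Y (k / 2), ⟨fun k => ?_, fun k => ?_⟩, ?_⟩
  · split_ifs
    · exact hX _
    · have := hY (k / 2)
      exact ⟨by linarith [this.2], by linarith [this.1]⟩
  · obtain ⟨j, rfl | rfl⟩ := Nat.even_or_odd' k
    · have h1 : (2 * j + 1) / 2 = j := by omega
      simp only [even_two_mul, if_true, Nat.not_even_bit1, if_false, h1]
      rw [Nat.mul_div_cancel_left j two_pos]
      exact hXY j
    · have h1 : (2 * j + 1) / 2 = j := by omega
      have h2 : (2 * j + 1 + 1) / 2 = j + 1 := by omega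
      have h3 : Even (2 * j + 1 + 1) := ⟨j + 1, by ring⟩
      simp only [Nat.not_even_bit1, if_false, h1, h2, h3, if_true]
      rw [wordMap_flipw hs hv]
  · simp [X]

namespace IsTailSeq

variable {s : ℕ} {ξ : ℝ} {w v : List ℕ} {n n' : ℕ → ℕ} {y y' : ℕ → ℝ}

theorem shift (hy : IsTailSeq s w v n y) (k : ℕ) :
    IsTailSeq s w v (fun i => n (k + i)) fun i => y (k + i) :=
  ⟨fun _ => hy.mem_Icc _, fun _ => hy.eq_wordMap _⟩

theorem eq_sub (hs : 2 ≤ s) (hv : IsOddExp s (1 - ξ) v) (hy : IsTailSeq s w v n y) (k : ℕ) :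
    y k = ξ - wordMap s (List.replicate (n k) w).flatten (y (k + 1)) / (s : ℝ) ^ v.length := by
  rw [hy.eq_wordMap, wordMap_flipw hs hv.1, wordMap_eq s v, hv.2.2.1]
  ring

theorem wordMap_mem_Icc (hs : 2 ≤ s) (hw : IsEvenExp s ξ w) (hy : IsTailSeq s w v n y)
    (r k : ℕ) : wordMap s (List.replicate r w).flatten (y k) ∈ Set.Icc (0 : ℝ) 1 :=
  _root_.wordMap_mem_Icc hs (flatten_replicate_lt hw.2.1 r) (hy.mem_Icc k)

theorem le (hs : 2 ≤ s) (hw : IsEvenExp s ξ w) (hv : IsOddExp s (1 - ξ) v)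
    (hy : IsTailSeq s w v n y) (k : ℕ) : y k ≤ ξ := by
  rw [hy.eq_sub hs hv]
  have := div_nonneg (hy.wordMap_mem_Icc hs hw (n k) (k + 1)).1
    (show (0 : ℝ) ≤ (s : ℝ) ^ v.length by positivity)
  linarith

theorem wordMap_succ (r : ℕ) (z : ℝ) : wordMap s (List.replicate (r + 1) w).flatten z =
    wordMap s w (wordMap s (List.replicate r w).flatten z) := by
  rw [List.replicate_succ, List.flatten_cons, wordMap_append]

theorem wordMap_le (hs : 2 ≤ s) (hw : IsEvenExp s ξ w) (hv : IsOddExp s (1 - ξ) v)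
    (hy : IsTailSeq s w v n y) (r k : ℕ) :
    wordMap s (List.replicate r w).flatten (y k) ≤ ξ + 1 / (s : ℝ) ^ w.length := by
  cases r with
  | zero =>
    have := hy.le hs hw hv k
    have h : 0 ≤ 1 / (s : ℝ) ^ w.length := by positivity
    rw [List.replicate_zero, List.flatten_nil, wordMap_nil]
    linarith
  | succ r =>
    rw [wordMap_succ, wordMap_eq, hw.2.2.2.1]
    gcongr
    exact (hy.wordMap_mem_Icc hs hw r k).2

theorem gmap_iterate_length_odd (hs : 2 ≤ s) (hw : IsEvenExp s ξ w) (hv : IsOddExp s (1 - ξ) v)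
    (hy : IsTailSeq s w v n y) (k : ℕ) (hpos : 0 < (gmap s)^[v.length] (y k)) :
    (gmap s)^[v.length] (y k) = wordMap s (List.replicate (n k) w).flatten (y (k + 1)) := by
  obtain ⟨h0, h1⟩ := hy.wordMap_mem_Icc hs hw (n k) (k + 1)
  have hlen : (flipw s v).length = v.length := by simp [flipw]
  rw [hy.eq_wordMap k] at hpos ⊢
  have h := (gmap_iterate_wordMap hs (flipw_lt hs v) ⟨by linarith, by linarith⟩ hlen.ge
    hpos).2 hv.2.1
  rw [h, ← hlen, List.drop_length, wordMap_nil, sub_sub_cancel]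

theorem gmap_iterate_length_even (hs : 2 ≤ s) (hw : IsEvenExp s ξ w)
    (hy : IsTailSeq s w v n y) (r k : ℕ)
    (hpos : 0 < (gmap s)^[w.length] (wordMap s (List.replicate (r + 1) w).flatten (y k))) :
    (gmap s)^[w.length] (wordMap s (List.replicate (r + 1) w).flatten (y k)) =
      wordMap s (List.replicate r w).flatten (y k) := by
  rw [wordMap_succ] at hpos ⊢
  have h := (gmap_iterate_wordMap hs hw.2.1 (hy.wordMap_mem_Icc hs hw r k) le_rfl hpos).1 hw.2.2.1
  rw [h, List.drop_length, wordMap_nil]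

theorem exists_iterate_eq (hs : 2 ≤ s) (hw : IsEvenExp s ξ w) (hv : IsOddExp s (1 - ξ) v)
    (hy : IsTailSeq s w v n y) (hpos : ∀ M, 0 < (gmap s)^[M] (y 0)) (k : ℕ) :
    ∃ M, k ≤ M ∧ (gmap s)^[M] (y 0) = y k := by
  have strip : ∀ r k M, (gmap s)^[M] (y 0) = wordMap s (List.replicate r w).flatten (y k) →
      ∃ M', M ≤ M' ∧ (gmap s)^[M'] (y 0) = y k := by
    intro r k
    induction r with
    | zero => exact fun M hM => ⟨M, le_rfl, hM⟩
    | succ r ih =>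
      intro M hM
      have hp := hpos (w.length + M)
      rw [Function.iterate_add_apply, hM] at hp
      obtain ⟨M', hle, hM'⟩ := ih (w.length + M) (by
        rw [Function.iterate_add_apply, hM, hy.gmap_iterate_length_even hs hw r k hp])
      exact ⟨M', by omega, hM'⟩
  induction k with
  | zero => exact ⟨0, le_rfl, rfl⟩
  | succ k ih =>
    obtain ⟨M, hle, hM⟩ := ih
    have hp := hpos (v.length + M)
    rw [Function.iterate_add_apply, hM] at hp
    obtain ⟨M', hle', hM'⟩ := strip (n k) (k + 1) (v.length + M) (by
      rw [Function.iterate_add_apply, hM, hy.gmap_iterate_length_odd hs hw hv k hp])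
    have := hv.2.1.pos
    exact ⟨M', by omega, hM'⟩

/-- If `x` lies below all normalized tails, it lies below the whole `g`-orbit of each of them. -/
theorem le_iterate (hs : 2 ≤ s) (hξ : IsPseudocenter s ξ) (hw : IsEvenExp s ξ w)
    (hv : IsOddExp s (1 - ξ) v) (hy : IsTailSeq s w v n y) {x : ℝ} (hx : ∀ k, x ≤ y k)
    (M r k : ℕ)
    (hpos : ∀ N, 0 < (gmap s)^[N] (wordMap s (List.replicate r w).flatten (y k))) :
    x ≤ (gmap s)^[M] (wordMap s (List.replicate r w).flatten (y k)) := by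
  have hxξ : x ≤ ξ := (hx 0).trans (hy.le hs hw hv 0)
  induction M using Nat.strong_induction_on generalizing r k with
  | _ M ih =>
    cases r with
    | zero =>
      have hnil (z : ℝ) : wordMap s (List.replicate 0 w).flatten z = z := rfl
      rw [hnil] at hpos ⊢
      rcases lt_or_ge M v.length with hlt | hge
      · rcases Nat.eq_zero_or_pos M with rfl | hM
        · exact hx k
        have hp := hpos M
        rw [hy.eq_wordMap k] at hp ⊢
        exact hxξ.trans (le_gmap_iterate_wordMap_odd hs hξ hw hv
          (hy.wordMap_mem_Icc hs hw _ _) (hy.wordMap_le hs hw hv _ _) hM.ne' hlt hp)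
      · obtain ⟨M, rfl⟩ := Nat.exists_eq_add_of_le' hge
        have hstep := hy.gmap_iterate_length_odd hs hw hv k (hpos _)
        rw [Function.iterate_add_apply, hstep]
        refine ih M (by have := hv.2.1.pos; omega) _ _ fun N => ?_
        rw [← hstep, ← Function.iterate_add_apply]
        exact hpos _
    | succ r =>
      rcases lt_or_ge M w.length with hlt | hge
      · have hp := hpos M
        rw [wordMap_succ] at hp ⊢
        exact hxξ.trans (le_gmap_iterate_wordMap_even hs hξ hw
          (hy.wordMap_mem_Icc hs hw _ _) (hy.wordMap_le hs hw hv _ _) hlt hp)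
      · obtain ⟨M, rfl⟩ := Nat.exists_eq_add_of_le' hge
        have hstep := hy.gmap_iterate_length_even hs hw r k (hpos _)
        rw [Function.iterate_add_apply, hstep]
        refine ih M (by have := List.length_pos_of_ne_nil hw.1; omega) _ _ fun N => ?_
        rw [← hstep, ← Function.iterate_add_apply]
        exact hpos _

theorem wordMap_lt_wordMap (hs : 2 ≤ s) (u : List ℕ) {a b : ℝ} (h : a < b) :
    wordMap s u a < wordMap s u b := by
  rw [wordMap_eq, wordMap_eq]
  gcongr

theorem lt_of_succ_lt (hs : 2 ≤ s) (hv : IsOddExp s (1 - ξ) v) (hy : IsTailSeq s w v n y)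
    (hy' : IsTailSeq s w v n' y') {k : ℕ} (hn : n k = n' k) (h : y' (k + 1) < y (k + 1)) :
    y k < y' k := by
  rw [hy.eq_sub hs hv, hy'.eq_sub hs hv, hn]
  have := wordMap_lt_wordMap hs (List.replicate (n' k) w).flatten h
  gcongr

theorem lt_of_exponent_lt (hs : 2 ≤ s) (hw : IsEvenExp s ξ w) (hv : IsOddExp s (1 - ξ) v)
    (hy : IsTailSeq s w v n y) (hy' : IsTailSeq s w v n' y') {k : ℕ} (hn : n' k < n k)
    (hpos : 0 < y (k + 1)) : y k < y' k := by
  rw [hy.eq_sub hs hv, hy'.eq_sub hs hv]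
  obtain ⟨d, hd⟩ := Nat.exists_eq_add_of_lt hn
  have h0 : 0 < wordMap s (List.replicate d w).flatten (y (k + 1)) := by
    rw [wordMap_eq]
    have := sval_nonneg s (List.replicate d w).flatten
    positivity
  have h1 : y' (k + 1) < wordMap s (List.replicate (d + 1) w).flatten (y (k + 1)) := by
    rw [wordMap_succ, wordMap_eq, hw.2.2.2.1]
    refine (hy'.le hs hw hv (k + 1)).trans_lt ?_
    have : 0 < wordMap s (List.replicate d w).flatten (y (k + 1)) / (s : ℝ) ^ w.length := by
      positivity
    linarith
  have h2 := wordMap_lt_wordMap hs (List.replicate (n' k) w).flatten h1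
  rw [← wordMap_append, ← List.flatten_append, List.replicate_append_replicate, ← add_assoc, ← hd]
    at h2
  gcongr

theorem lt_of_first_diff (hs : 2 ≤ s) (hw : IsEvenExp s ξ w) (hv : IsOddExp s (1 - ξ) v)
    (hy : IsTailSeq s w v n y) (hy' : IsTailSeq s w v n' y') (hpos : ∀ i, 0 < y i)
    (hpos' : ∀ i, 0 < y' i) {k : ℕ} (heq : ∀ j < k, n j = n' j)
    (h : (Even k ∧ n' k < n k) ∨ (¬ Even k ∧ n k < n' k)) : y 0 < y' 0 := by
  induction k generalizing n n' y y' with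
  | zero =>
    rcases h with ⟨-, h⟩ | ⟨h, -⟩
    · exact hy.lt_of_exponent_lt hs hw hv hy' h (hpos _)
    · simp at h
  | succ k ih =>
    refine hy.lt_of_succ_lt hs hv hy' (heq 0 k.succ_pos) ?_
    refine ih (n := fun i => n' (1 + i)) (n' := fun i => n (1 + i)) (y := fun i => y' (1 + i))
      (y' := fun i => y (1 + i)) (hy'.shift 1) (hy.shift 1) (fun i => hpos' _) (fun i => hpos _)
      (fun j hj => (heq (1 + j) (by omega)).symm) ?_
    rw [Nat.even_add_one, not_not] at h
    simp only [add_comm 1]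
    tauto

theorem eq_of_exponent_eq (hs : 2 ≤ s) (hv : IsOddExp s (1 - ξ) v)
    (hy : IsTailSeq s w v n y) (hy' : IsTailSeq s w v n y') : y 0 = y' 0 := by
  have hs2 : (2 : ℝ) ≤ s := by exact_mod_cast hs
  have key : ∀ N k, |y k - y' k| ≤ (1 / 2 : ℝ) ^ N := by
    intro N
    induction N with
    | zero =>
      intro k
      obtain ⟨a, b⟩ := hy.mem_Icc k
      obtain ⟨a', b'⟩ := hy'.mem_Icc k
      rw [pow_zero, abs_le]
      constructor <;> linarith
    | succ N ih =>
      intro k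
      set u := (List.replicate (n k) w).flatten
      have h1 : (1 : ℝ) ≤ (s : ℝ) ^ u.length := one_le_pow₀ (by linarith)
      have h2 : (2 : ℝ) ≤ (s : ℝ) ^ v.length :=
        hs2.trans (le_self_pow₀ (by linarith) hv.2.1.pos.ne')
      have e : y k - y' k =
          -((y (k + 1) - y' (k + 1)) / ((s : ℝ) ^ u.length * (s : ℝ) ^ v.length)) := by
        rw [hy.eq_sub hs hv, hy'.eq_sub hs hv, wordMap_eq, wordMap_eq, ← div_div]
        ring
      have h3 : (2 : ℝ) ≤ (s : ℝ) ^ u.length * (s : ℝ) ^ v.length := by nlinarith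
      rw [e, abs_neg, abs_div, abs_of_pos (by linarith : 0 < (s : ℝ) ^ u.length * _),
        div_le_iff₀ (by linarith), pow_succ]
      have := ih (k + 1)
      have hp : (0 : ℝ) < (1 / 2) ^ N := by positivity
      nlinarith
  have h0 : |y 0 - y' 0| ≤ 0 := ge_of_tendsto'
    (tendsto_pow_atTop_nhds_zero_of_lt_one (by norm_num) (by norm_num)) fun N => key N 0
  exact sub_eq_zero.1 (abs_nonpos_iff.1 h0)

end IsTailSeq

theorem ALOle_or_strict (a b : ℕ → ℕ) :
    ALOle a b ∨ ∃ k : ℕ, (∀ j < k, b j = a j) ∧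
      ((Even k ∧ a k < b k) ∨ (¬ Even k ∧ b k < a k)) := by
  classical
  by_cases h : ∃ k, a k ≠ b k
  · have hmin : ∀ j < Nat.find h, a j = b j := fun j hj => not_not.1 (Nat.find_min h hj)
    have hne := Nat.find_spec h
    by_cases he : Even (Nat.find h) <;> rcases lt_or_gt_of_ne hne with hlt | hlt
    · exact Or.inr ⟨_, fun j hj => (hmin j hj).symm, Or.inl ⟨he, hlt⟩⟩
    · exact Or.inl (Or.inr ⟨_, hmin, Or.inl ⟨he, hlt⟩⟩)
    · exact Or.inl (Or.inr ⟨_, hmin, Or.inr ⟨he, hlt⟩⟩)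
    · exact Or.inr ⟨_, fun j hj => (hmin j hj).symm, Or.inr ⟨he, hlt⟩⟩
  · push Not at h
    exact Or.inl (Or.inl (funext h))

/-- a point `x ∈ K(ξ_T) ∩ [0, ξ_L]` with admissible expansion
`x = .v̌ w̌^{n₁} v w^{n₂} v̌ w̌^{n₃} v w^{n₄}…` belongs to the bifurcation set `E` if and
only if `(n₁, n₂, …) ⪯_ALO (n_k, n_{k+1}, …)` for every `k ≥ 1`. -/
theorem bifurcation_in_tuning_window_iff_ALO_minimal
    (s : ℕ) (hs : 2 ≤ s) (ξ : ℝ) (hξ : IsPseudocenter s ξ)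
    (w v : List ℕ) (hw : IsEvenExp s ξ w) (hv : IsOddExp s (1 - ξ) v)
    (x : ℝ) (hxK : x ∈ Kset s (xiT s w v))
    (hxL : x ≤ pval s (flipw s v ++ v))
    (n : ℕ → ℕ) (hx : x = concatVal s (unitBlock s w v n)) :
    x ∈ Eset s ↔ ∀ k : ℕ, ALOle n (fun i => n (k + i)) := by
  obtain ⟨y, hy, hy0⟩ := exists_isTailSeq hs hw.2.1 hv.1 n
  rw [← hy0] at hx
  subst hx
  have hpos : ∀ M, 0 < (gmap s)^[M] (y 0) := fun M => (xiT_pos hs hξ hw).trans_le (hxK.2 M)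
  have hypos : ∀ k, 0 < y k := by
    intro k
    obtain ⟨M, -, hM⟩ := hy.exists_iterate_eq hs hw hv hpos k
    exact hM ▸ hpos M
  constructor
  · intro hE k
    rcases ALOle_or_strict n fun i => n (k + i) with h | ⟨j, hj, h⟩
    · exact h
    have hlt := (hy.shift k).lt_of_first_diff hs hw hv hy (fun i => hypos _) hypos hj h
    obtain ⟨M, hkM, hM⟩ := hy.exists_iterate_eq hs hw hv hpos k
    rcases Nat.eq_zero_or_pos M with rfl | hM0
    · exact absurd hM (by simpa using hlt.ne')
    · have := hE.2 M hM0
      rw [hM] at this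
      exact absurd hlt (by simpa using this)
  · intro h
    have hmin : ∀ k, y 0 ≤ y k := by
      intro k
      rcases h k with heq | ⟨j, hj, hlt⟩
      · have hs' := hy.shift k
        rw [← heq] at hs'
        exact (hy.eq_of_exponent_eq hs hv hs').le
      · exact (hy.lt_of_first_diff hs hw hv (hy.shift k) hypos (fun i => hypos _) hj hlt).le
    exact ⟨hxK.1, fun M _ => hy.le_iterate hs hξ hw hv hmin M 0 0 hpos⟩
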